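/- Let u be a classical solution of the boundary reaction problem with |u| < 1 on ℝ × [0,∞), ∂_t u(t,0) > 0 for every t ∈ ℝ, and u(t,0) → ±1 as t → ±∞. Then for every fixed y > 0 the function t ↦ u(t,y) is strictly increasing on ℝ. -/

import Mathlib

open Real Filter MeasureTheory Set Topology

noncomputable def pt (u : ℝ → ℝ → ℝ) (t y : ℝ) : ℝ := deriv (fun s => u s y) t
noncomputable def py (u : ℝ → ℝ → ℝ) (t y : ℝ) : ℝ := deriv (fun z => u t z) y
noncomputable def ptt (u : ℝ → ℝ → ℝ) (t y : ℝ) : ℝ := deriv (fun s => pt u s y) t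
noncomputable def pyy (u : ℝ → ℝ → ℝ) (t y : ℝ) : ℝ := deriv (fun z => py u t z) y
noncomputable def pty (u : ℝ → ℝ → ℝ) (t y : ℝ) : ℝ := deriv (fun z => pt u t z) y

/-- The degenerate elliptic operator `H_a u = u_yy + (a/y) u_y + u_tt + (n-1) tanh t · u_t`. -/
noncomputable def Ha (n : ℕ) (a : ℝ) (u : ℝ → ℝ → ℝ) (t y : ℝ) : ℝ :=
  pyy u t y + (a / y) * py u t y + ptt u t y + ((n : ℝ) - 1) * Real.tanh t * pt u t y

/-- A classical solution of the boundary reaction problem: a bounded continuous function on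
`ℝ × [0,∞)`, `C²` on `ℝ × (0,∞)`, with `H_a u = 0` there, `∂_t u` extending continuously to
`ℝ × [0,∞)`, and for every `t` the limit `lim_{y→0⁺} y^a ∂_y u(t,y)` exists and equals
`-f(u(t,0)) = F'(u(t,0))`, where `f = -F'`. -/
structure BRSolution (n : ℕ) (a : ℝ) (F : ℝ → ℝ) (u : ℝ → ℝ → ℝ) : Prop where
  bounded : ∃ M : ℝ, ∀ t y : ℝ, 0 ≤ y → |u t y| ≤ M
  cont : ContinuousOn (fun p : ℝ × ℝ => u p.1 p.2) {p : ℝ × ℝ | 0 ≤ p.2}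
  smooth : ContDiffOn ℝ 2 (fun p : ℝ × ℝ => u p.1 p.2) {p : ℝ × ℝ | 0 < p.2}
  eqn : ∀ t y : ℝ, 0 < y → Ha n a u t y = 0
  pt_cont : ContinuousOn (fun p : ℝ × ℝ => pt u p.1 p.2) {p : ℝ × ℝ | 0 ≤ p.2}
  bc : ∀ t : ℝ, Tendsto (fun y : ℝ => y ^ a * py u t y) (𝓝[>] (0:ℝ))
        (𝓝 (deriv F (u t 0)))

/-- `F` is a smooth double-well potential: `F(±1) = 0`, `F > 0` on `(-1,1)`,
`F'(±1) = 0`, `F''(±1) > 0`. -/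
def DoubleWell (F : ℝ → ℝ) : Prop :=
  ContDiff ℝ (⊤ : ℕ∞) F ∧ F (-1) = 0 ∧ F 1 = 0 ∧ (∀ s ∈ Set.Ioo (-1:ℝ) 1, 0 < F s) ∧
    deriv F (-1) = 0 ∧ deriv F 1 = 0 ∧
    0 < iteratedDeriv 2 F (-1) ∧ 0 < iteratedDeriv 2 F 1

/-- First and second order conditions at a local minimum. -/
theorem second_deriv_test {h h' : ℝ → ℝ} {h'' x : ℝ} (hmin : IsLocalMin h x)
    (h1 : ∀ᶠ z in 𝓝 x, HasDerivAt h (h' z) z) (h2 : HasDerivAt h' h'' x) :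
    h' x = 0 ∧ 0 ≤ h'' := by
  have h0 : h' x = 0 := hmin.hasDerivAt_eq_zero h1.self_of_nhds
  refine ⟨h0, ?_⟩
  by_contra! hneg
  have hd : deriv h =ᶠ[𝓝 x] h' := h1.mono fun z hz => hz.deriv
  have hdd : deriv (deriv h) x = h'' := by rw [hd.deriv_eq]; exact h2.deriv
  have hmax : IsLocalMax h x := isLocalMax_of_deriv_deriv_neg (by rw [hdd]; exact hneg)
    (by rw [hd.self_of_nhds]; exact h0) h1.self_of_nhds.continuousAt
  have hc : h =ᶠ[𝓝 x] fun _ => h x := by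
    filter_upwards [hmin, hmax] with z hz hz'
    exact le_antisymm hz' hz
  have hdc : deriv h =ᶠ[𝓝 x] fun _ => 0 := by
    filter_upwards [hc.eventuallyEq_nhds] with z hz
    rw [hz.deriv_eq]; simp
  have : deriv (deriv h) x = 0 := by rw [hdc.deriv_eq]; simp
  linarith

theorem hasDerivAt_deriv_of_contDiffAt_two {h : ℝ → ℝ} {x : ℝ} (hh : ContDiffAt ℝ 2 h x) :
    (∀ᶠ z in 𝓝 x, HasDerivAt h (deriv h z) z) ∧ HasDerivAt (deriv h) (deriv (deriv h) x) x := by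
  constructor
  · filter_upwards [hh.eventually (by simp)] with z hz
    exact (hz.differentiableAt (by simp)).hasDerivAt
  · have : ContDiffAt ℝ 1 (deriv h) x := 
      (hh.fderiv_right (m := 1) (by norm_num)).clm_apply contDiffAt_const
    exact (this.differentiableAt (by simp)).hasDerivAt

theorem hasDerivAt_tanh (x : ℝ) : HasDerivAt Real.tanh (1 - Real.tanh x ^ 2) x := by
  have h : Real.tanh = fun x => Real.sinh x / Real.cosh x := by
    ext x; exact Real.tanh_eq_sinh_div_cosh x
  have hc := (Real.cosh_pos x).ne'
  have := (Real.hasDerivAt_sinh x).div (Real.hasDerivAt_cosh x) hc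
  rw [Real.tanh_eq_sinh_div_cosh, h]
  convert! this using 1
  field_simp

theorem hasDerivAt_log_cosh (x : ℝ) :
    HasDerivAt (fun x => Real.log (Real.cosh x)) (Real.tanh x) x := by
  rw [Real.tanh_eq_sinh_div_cosh]
  exact (Real.hasDerivAt_cosh x).log (Real.cosh_pos x).ne'

theorem log_cosh_nonneg (x : ℝ) : 0 ≤ Real.log (Real.cosh x) :=
  Real.log_nonneg (Real.one_le_cosh x)

theorem abs_le_log_cosh_add_one (x : ℝ) : |x| ≤ Real.log (Real.cosh x) + 1 := by
  have h1 : Real.exp |x| / 2 ≤ Real.cosh x := by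
    rw [← Real.cosh_abs, Real.cosh_eq]
    linarith [Real.exp_pos (-|x|)]
  have h2 := Real.log_le_log (by positivity) h1
  rw [Real.log_div (Real.exp_pos _).ne' two_ne_zero, Real.log_exp] at h2
  linarith [Real.log_two_lt_d9]

theorem hasDerivAt_logarithmic_deriv {G G' : ℝ → ℝ} {G'' x : ℝ}
    (h : HasDerivAt G (G' x) x) (h' : HasDerivAt G' G'' x) (hx : 0 < G x) :
    HasDerivAt (fun z => G' z / G z) (G'' / G x - (G' x / G x) ^ 2) x := by
  convert! h'.div h hx.ne' using 1
  field_simp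

theorem inv_le_rpow_sub_two {β y G : ℝ} (hβ : 0 < β) (hβ2 : β < 2) (hy : 0 < y)
    (hG : 1 + y ^ 2 ≤ G) : G⁻¹ ≤ y ^ (β - 2) := by
  have h : y ^ (2 - β) ≤ G := by
    refine le_trans ?_ hG
    rcases le_total y 1 with h | h
    · have := Real.rpow_le_one hy.le h (by linarith : 0 ≤ 2 - β)
      nlinarith [sq_nonneg y]
    · have := Real.rpow_le_rpow_of_exponent_le h (by linarith : 2 - β ≤ 2)
      norm_num at this
      linarith
  have h2 : y ^ (β - 2) = (y ^ (2 - β))⁻¹ := by rw [← Real.rpow_neg hy.le]; ring_nf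
  rw [h2]
  exact inv_anti₀ (by positivity) h

/-- The bump `(r² - (x - c)²)²`, positive on `(c - r, c + r)` and zero at the endpoints. -/
noncomputable def bump (r c x : ℝ) : ℝ := (r ^ 2 - (x - c) ^ 2) ^ 2

/-- The derivative of `bump r c`. -/
noncomputable def bumpDeriv (r c x : ℝ) : ℝ := -4 * (x - c) * (r ^ 2 - (x - c) ^ 2)

theorem hasDerivAt_bump (r c x : ℝ) : HasDerivAt (bump r c) (bumpDeriv r c x) x := by
  unfold bump bumpDeriv
  convert! ((((hasDerivAt_id x).sub_const c).pow 2).const_sub (r ^ 2)).pow 2 using 1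
  simp
  ring

theorem hasDerivAt_bumpDeriv (r c x : ℝ) :
    HasDerivAt (bumpDeriv r c) (8 * r ^ 2 - 12 * (r ^ 2 - (x - c) ^ 2)) x := by
  unfold bumpDeriv
  convert! (((hasDerivAt_id x).sub_const c).const_mul (-4)).mul
    ((((hasDerivAt_id x).sub_const c).pow 2).const_sub (r ^ 2)) using 1
  simp
  ring

theorem bump_nonneg (r c x : ℝ) : 0 ≤ bump r c x := sq_nonneg _

theorem bump_add (r c : ℝ) : bump r c (c + r) = 0 := by simp [bump]

theorem bump_sub (r c : ℝ) : bump r c (c - r) = 0 := by simp [bump]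

theorem bump_pos {r c x : ℝ} (hx : |x - c| < r) : 0 < bump r c x := by
  have := sq_lt_sq' (neg_lt_of_abs_lt hx) (lt_of_abs_lt hx)
  exact pow_pos (by linarith) 2

theorem bump_le {r c x : ℝ} (hx : |x - c| ≤ r) : bump r c x ≤ r ^ 4 := by
  have := sq_le_sq' (neg_le_of_abs_le hx) (le_of_abs_le hx)
  calc bump r c x ≤ (r ^ 2) ^ 2 :=
        pow_le_pow_left₀ (by linarith) (by linarith [sq_nonneg (x - c)]) 2
    _ = r ^ 4 := by ring

/-- The bump is a subsolution of an eigenvalue problem with bounded drift `d`. -/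
theorem bump_subsolution {r c N d x : ℝ} (hr : 0 < r) (hd : |d| ≤ N) (hx : |x - c| < r) :
    -((12 + 4 * N * r) ^ 2 / (32 * r ^ 2)) * bump r c x
      ≤ (8 * r ^ 2 - 12 * (r ^ 2 - (x - c) ^ 2)) + d * bumpDeriv r c x := by
  unfold bump bumpDeriv
  generalize x - c = x at *
  have hq : 0 < r ^ 2 - x ^ 2 := by
    have := sq_lt_sq' (neg_lt_of_abs_lt hx) (lt_of_abs_lt hx)
    linarith
  have hdx : d * x ≤ N * r := by
    refine (le_abs_self _).trans ?_
    rw [abs_mul]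
    exact mul_le_mul hd hx.le (abs_nonneg _) ((abs_nonneg _).trans hd)
  have h1 : d * x * (r ^ 2 - x ^ 2) ≤ N * r * (r ^ 2 - x ^ 2) :=
    mul_le_mul_of_nonneg_right hdx hq.le
  have h2 : 0 ≤ (16 * r ^ 2 - (12 + 4 * N * r) * (r ^ 2 - x ^ 2)) ^ 2 / (32 * r ^ 2) := by
    positivity
  have h3 : (16 * r ^ 2 - (12 + 4 * N * r) * (r ^ 2 - x ^ 2)) ^ 2 / (32 * r ^ 2)
      = 8 * r ^ 2 - (12 + 4 * N * r) * (r ^ 2 - x ^ 2)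
        + (12 + 4 * N * r) ^ 2 / (32 * r ^ 2) * (r ^ 2 - x ^ 2) ^ 2 := by
    field_simp
    ring
  rw [h3] at h2
  linarith

theorem hasDerivAt_exp_neg_mul (μ y : ℝ) :
    HasDerivAt (fun y => Real.exp (-(μ * y))) (-μ * Real.exp (-(μ * y))) y := by
  convert! ((hasDerivAt_id y).const_mul μ).neg.exp using 1
  simp
  ring

theorem exp_barrier_subsolution {a η y lam μ κ : ℝ} (ha : a < 1) (hη : 0 < η) (hy : η ≤ y)
    (hlam : 0 ≤ lam) (hμ : μ = η⁻¹ + 2 * lam + 1) (hκ : 0 ≤ κ) :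
    2 * lam * (Real.exp (-(μ * y)) - κ)
      < -μ * (-μ * Real.exp (-(μ * y))) + a / y * (-μ * Real.exp (-(μ * y))) := by
  have hy0 : 0 < y := hη.trans_le hy
  have hη' : 0 < η⁻¹ := inv_pos.2 hη
  have h1 : a / y ≤ η⁻¹ := by
    rw [div_eq_mul_inv]
    exact (mul_le_of_le_one_left (inv_pos.2 hy0).le ha.le).trans (inv_anti₀ hη hy)
  have h2 : 2 * lam + 1 ≤ μ * (μ - a / y) := by
    have h3 : 2 * lam + 1 ≤ μ - a / y := by linarith
    exact h3.trans (le_mul_of_one_le_left (by linarith) (by linarith))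
  calc 2 * lam * (Real.exp (-(μ * y)) - κ) ≤ 2 * lam * Real.exp (-(μ * y)) :=
        mul_le_mul_of_nonneg_left (sub_le_self _ hκ) (by linarith)
    _ < μ * (μ - a / y) * Real.exp (-(μ * y)) :=
        mul_lt_mul_of_pos_right (by linarith) (Real.exp_pos _)
    _ = _ := by ring

section BRSolution

variable {n : ℕ} {a : ℝ} {F : ℝ → ℝ} {u : ℝ → ℝ → ℝ}

theorem BRSolution.contDiffAt (hu : BRSolution n a F u) {t y : ℝ} (hy : 0 < y) :
    ContDiffAt ℝ 2 (fun p : ℝ × ℝ => u p.1 p.2) (t, y) :=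
  hu.smooth.contDiffAt ((isOpen_lt continuous_const continuous_snd).mem_nhds hy)

theorem BRSolution.contDiffAt_left (hu : BRSolution n a F u) {t y : ℝ} (hy : 0 < y) :
    ContDiffAt ℝ 2 (fun s => u s y) t :=
  (hu.contDiffAt hy).comp t (f := fun s : ℝ => (s, y)) (by fun_prop)

theorem BRSolution.contDiffAt_right (hu : BRSolution n a F u) {t y : ℝ} (hy : 0 < y) :
    ContDiffAt ℝ 2 (fun z => u t z) y :=
  (hu.contDiffAt hy).comp y (f := fun z : ℝ => (t, z)) (by fun_prop)

/-- If `u s y - u t y + φ(s, t, y)` has a minimum in each variable at a point with `0 < y`, then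
the doubled operator applied to `φ` is nonnegative there; `f`, `g`, `h` are the restrictions of `φ`
to the coordinate lines through that point. -/
theorem BRSolution.doubled_nonneg (hu : BRSolution n a F u) {s t y : ℝ} (hy : 0 < y)
    {f f' g g' h h' : ℝ → ℝ} {f'' g'' h'' : ℝ}
    (hf : ∀ᶠ x in 𝓝 s, HasDerivAt f (f' x) x) (hf' : HasDerivAt f' f'' s)
    (hg : ∀ᶠ x in 𝓝 t, HasDerivAt g (g' x) x) (hg' : HasDerivAt g' g'' t)
    (hh : ∀ᶠ x in 𝓝 y, HasDerivAt h (h' x) x) (hh' : HasDerivAt h' h'' y)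
    (mf : IsLocalMin (fun x => u x y - u t y + f x) s)
    (mg : IsLocalMin (fun x => u s y - u x y + g x) t)
    (mh : IsLocalMin (fun x => u s x - u t x + h x) y) :
    0 ≤ h'' + a / y * h' y + (f'' + (n - 1) * Real.tanh s * f' s)
      + (g'' + (n - 1) * Real.tanh t * g' t) := by
  obtain ⟨a1, a2⟩ := hasDerivAt_deriv_of_contDiffAt_two (hu.contDiffAt_left (t := s) hy)
  obtain ⟨b1, b2⟩ := hasDerivAt_deriv_of_contDiffAt_two (hu.contDiffAt_left (t := t) hy)
  obtain ⟨c1, c2⟩ := hasDerivAt_deriv_of_contDiffAt_two (hu.contDiffAt_right (t := s) hy)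
  obtain ⟨d1, d2⟩ := hasDerivAt_deriv_of_contDiffAt_two (hu.contDiffAt_right (t := t) hy)
  obtain ⟨f1, f2⟩ := second_deriv_test mf
    (by filter_upwards [a1, hf] with x h1 h2; exact (h1.sub_const _).add h2) (a2.add hf')
  obtain ⟨g1, g2⟩ := second_deriv_test mg
    (by filter_upwards [b1, hg] with x h1 h2; exact (h1.const_sub _).add h2) (b2.neg.add hg')
  obtain ⟨h1, h2⟩ := second_deriv_test mh
    (by filter_upwards [c1, d1, hh] with x h1 h2 h3; exact (h1.sub h2).add h3)
    ((c2.sub d2).add hh')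
  have es := hu.eqn s y hy
  have et := hu.eqn t y hy
  simp only [Ha, pyy, py, ptt, pt] at es et
  simp only [Pi.add_apply, Pi.sub_apply, Pi.neg_apply] at f1 g1 h1
  linear_combination f2 + g2 + h2 + es - et - a / y * h1 - (n - 1) * Real.tanh s * f1
    - (n - 1) * Real.tanh t * g1

theorem BRSolution.continuousOn_sub (hu : BRSolution n a F u) :
    ContinuousOn (fun p : ℝ × ℝ × ℝ => u p.1 p.2.2 - u p.2.1 p.2.2) {p | 0 ≤ p.2.2} := by
  apply ContinuousOn.sub
  · exact hu.cont.comp (f := fun p : ℝ × ℝ × ℝ => (p.1, p.2.2)) (by fun_prop) fun p hp => hp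
  · exact hu.cont.comp (f := fun p : ℝ × ℝ × ℝ => (p.2.1, p.2.2)) (by fun_prop) fun p hp => hp

set_option maxHeartbeats 1000000 in
/-- Solutions with nondecreasing trace are nondecreasing in `t` at every height. -/
theorem BRSolution.monotone_of_trace (hu : BRSolution n a F u) (hn : 2 ≤ n)
    (ha : a ∈ Set.Ioo (-1 : ℝ) 1) (h0 : Monotone fun t => u t 0) {y₀ : ℝ} (hy₀ : 0 < y₀) :
    Monotone fun t => u t y₀ := by
  intro t₀ s₀ hts₀
  by_contra! hlt
  obtain ⟨M, hM⟩ := hu.bounded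
  obtain ⟨ha1, ha2⟩ := ha
  have hn' : (2 : ℝ) ≤ n := by exact_mod_cast hn
  set β : ℝ := (1 - a) / 2 with hβ
  have hβ0 : 0 < β := by rw [hβ]; linarith
  have hβ2 : β < 2 := by rw [hβ]; linarith
  set C : ℝ := (2 * n + 5) / β ^ 2 with hC
  have hC0 : 0 < C := by positivity
  let G : ℝ → ℝ → ℝ → ℝ := fun s t y => 1 + Real.log (Real.cosh s) + Real.log (Real.cosh t) + y ^ 2
  have hG1 : ∀ s t y, 1 + y ^ 2 ≤ G s t y := fun s t y => by
    have := log_cosh_nonneg s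
    have := log_cosh_nonneg t
    simp only [G]; linarith
  have hGpos : ∀ s t y, 0 < G s t y := fun s t y => by nlinarith [hG1 s t y, sq_nonneg y]
  let Φ : ℝ → ℝ → ℝ → ℝ := fun s t y => Real.log (G s t y) + C * y ^ β
  have hlogG : ∀ s t y, 0 ≤ Real.log (G s t y) := fun s t y =>
    Real.log_nonneg (by nlinarith [hG1 s t y, sq_nonneg y])
  have hΦ0 : ∀ s t y, 0 ≤ y → 0 ≤ Φ s t y := fun s t y hy =>
    add_nonneg (hlogG s t y) (mul_nonneg hC0.le (Real.rpow_nonneg hy _))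
  obtain ⟨ε, hε, hεlt⟩ : ∃ ε > 0, u s₀ y₀ - u t₀ y₀ + ε * Φ s₀ t₀ y₀ < 0 := by
    have := hΦ0 s₀ t₀ y₀ hy₀.le
    refine ⟨(u t₀ y₀ - u s₀ y₀) / (Φ s₀ t₀ y₀ + 1), by apply div_pos <;> linarith, ?_⟩
    have h2 : (u t₀ y₀ - u s₀ y₀) / (Φ s₀ t₀ y₀ + 1) * Φ s₀ t₀ y₀ < u t₀ y₀ - u s₀ y₀ := by
      rw [div_mul_eq_mul_div, div_lt_iff₀ (by linarith)]
      nlinarith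
    linarith
  let V : ℝ → ℝ → ℝ → ℝ := fun s t y => u s y - u t y + ε * Φ s t y
  set B : ℝ := Real.exp (2 * M / ε) + 1 with hB
  have hcoer : ∀ s t y, 0 ≤ y → V s t y < 0 → |s| < B ∧ |t| < B ∧ y < B := by
    intro s t y hy hV
    have h1 := abs_le.1 (hM s y hy)
    have h2 := abs_le.1 (hM t y hy)
    have h3 : Real.log (G s t y) < 2 * M / ε := by
      rw [lt_div_iff₀ hε]
      have h4 : 0 ≤ C * y ^ β := by positivity
      simp only [V, Φ] at hV
      nlinarith
    have h5 : G s t y < Real.exp (2 * M / ε) := (Real.log_lt_iff_lt_exp (hGpos s t y)).1 h3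
    have := log_cosh_nonneg s
    have := log_cosh_nonneg t
    have := abs_le_log_cosh_add_one s
    have := abs_le_log_cosh_add_one t
    simp only [G] at h5
    refine ⟨?_, ?_, ?_⟩ <;> nlinarith [sq_nonneg y, sq_nonneg (y - 1)]
  let K : Set (ℝ × ℝ × ℝ) := (Icc (-B) B ×ˢ Icc (-B) B ×ˢ Icc 0 B) ∩ {p | p.2.1 ≤ p.1}
  have hK : IsCompact K :=
    (isCompact_Icc.prod (isCompact_Icc.prod isCompact_Icc)).inter_right
      (isClosed_le (by fun_prop) (by fun_prop))
  have hVc : ContinuousOn (fun p : ℝ × ℝ × ℝ => V p.1 p.2.1 p.2.2) K := by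
    refine (hu.continuousOn_sub.mono fun p hp => hp.1.2.2.1).add (Continuous.continuousOn ?_)
    refine continuous_const.mul (Continuous.add (Continuous.log ?_ fun p => (hGpos _ _ _).ne') ?_)
    · have hlc : Continuous fun x => Real.log (Real.cosh x) :=
        Real.continuous_cosh.log fun x => (Real.cosh_pos x).ne'
      have e1 := hlc.comp (continuous_fst (X := ℝ) (Y := ℝ × ℝ))
      have e2 := hlc.comp (continuous_fst.comp (continuous_snd (X := ℝ) (Y := ℝ × ℝ)))
      exact ((continuous_const.add e1).add e2).add (by fun_prop)
    · exact continuous_const.mul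
        ((continuous_snd.comp continuous_snd).rpow_const fun _ => Or.inr hβ0.le)
  have hmemK : ∀ s t y, t ≤ s → 0 ≤ y → V s t y < 0 → (s, t, y) ∈ K := by
    intro s t y hts hy hV
    obtain ⟨h1, h2, h3⟩ := hcoer s t y hy hV
    exact ⟨⟨abs_le.1 h1.le, abs_le.1 h2.le, hy, h3.le⟩, hts⟩
  have hp₀ := hmemK s₀ t₀ y₀ hts₀ hy₀.le hεlt
  obtain ⟨⟨s, t, y⟩, hp, hmin⟩ := hK.exists_isMinOn ⟨_, hp₀⟩ hVc
  have hV : V s t y < 0 := (hmin hp₀).trans_lt hεlt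
  have hy0 : 0 ≤ y := hp.1.2.2.1
  have hmin' : ∀ s' t' y', t' ≤ s' → 0 ≤ y' → V s t y ≤ V s' t' y' := by
    intro s' t' y' hts hy
    by_cases h : V s' t' y' < 0
    · exact hmin (hmemK s' t' y' hts hy h)
    · linarith
  have hεΦ : 0 ≤ ε * Φ s t y := mul_nonneg hε.le (hΦ0 s t y hy0)
  have hts : t < s := by
    refine lt_of_le_of_ne hp.2 ?_
    rintro rfl
    simp only [V] at hV
    linarith
  have hy : 0 < y := by
    refine lt_of_le_of_ne hy0 ?_
    rintro rfl
    have : u t 0 ≤ u s 0 := h0 hts.le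
    simp only [V] at hV
    linarith
  have key := hu.doubled_nonneg (s := s) (t := t) hy
    (f := fun x => ε * Φ x t y) (f' := fun x => ε * (Real.tanh x / G x t y))
    (g := fun x => ε * Φ s x y) (g' := fun x => ε * (Real.tanh x / G s x y))
    (h := fun x => ε * Φ s t x)
    (h' := fun x => ε * (2 * x / G s t x + C * (β * x ^ (β - 1))))
    (f'' := ε * ((1 - Real.tanh s ^ 2) / G s t y - (Real.tanh s / G s t y) ^ 2))
    (g'' := ε * ((1 - Real.tanh t ^ 2) / G s t y - (Real.tanh t / G s t y) ^ 2))
    (h'' := ε * ((2 / G s t y - (2 * y / G s t y) ^ 2)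
      + C * (β * ((β - 1) * y ^ (β - 1 - 1)))))
  have dG1 : ∀ x, HasDerivAt (fun x => G x t y) (Real.tanh x) x := fun x =>
    (((hasDerivAt_log_cosh x).const_add 1).add_const _).add_const _
  have dG2 : ∀ x, HasDerivAt (fun x => G s x y) (Real.tanh x) x := fun x =>
    ((hasDerivAt_log_cosh x).const_add _).add_const _
  have dG3 : ∀ x, HasDerivAt (fun x => G s t x) (2 * x) x := fun x => by
    refine HasDerivAt.const_add (1 + Real.log (Real.cosh s) + Real.log (Real.cosh t)) ?_
    simpa using hasDerivAt_pow 2 x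
  have hineq := key
    (Eventually.of_forall fun x => (((dG1 x).log (hGpos _ _ _).ne').add_const _).const_mul ε)
    ((hasDerivAt_logarithmic_deriv (dG1 s) (hasDerivAt_tanh s) (hGpos _ _ _)).const_mul ε)
    (Eventually.of_forall fun x => (((dG2 x).log (hGpos _ _ _).ne').add_const _).const_mul ε)
    ((hasDerivAt_logarithmic_deriv (dG2 t) (hasDerivAt_tanh t) (hGpos _ _ _)).const_mul ε)
    (by
      filter_upwards [lt_mem_nhds hy] with x hx
      exact (((dG3 x).log (hGpos _ _ _).ne').add
        ((Real.hasDerivAt_rpow_const (Or.inl hx.ne')).const_mul C)).const_mul ε)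
    (((hasDerivAt_logarithmic_deriv (dG3 y)
        (by simpa using (hasDerivAt_id y).const_mul 2) (hGpos _ _ _)).add
      (((Real.hasDerivAt_rpow_const (Or.inl hy.ne')).const_mul β).const_mul C)).const_mul ε)
    (by
      filter_upwards [lt_mem_nhds hts] with x hx
      exact hmin' x t y hx.le hy0)
    (by
      filter_upwards [gt_mem_nhds hts] with x hx
      exact hmin' s x y hx.le hy0)
    (by
      filter_upwards [lt_mem_nhds hy] with x hx
      exact hmin' s t x hts.le hx.le)
  have hA := inv_le_rpow_sub_two hβ0 hβ2 hy (hG1 s t y)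
  have hA0 : 0 < y ^ (β - 2) := Real.rpow_pos_of_pos hy _
  have e1 : y ^ (β - 1) = y ^ (β - 2) * y := by
    rw [← Real.rpow_add_one hy.ne']; ring_nf
  have e2 : β - 1 - 1 = β - 2 := by ring
  rw [e1, e2] at hineq
  have hg0 : 0 < (G s t y)⁻¹ := inv_pos.2 (hGpos s t y)
  have hT := (Real.tanh_sq_lt_one s).le
  have hS := (Real.tanh_sq_lt_one t).le
  have hCβ : C * β ^ 2 = 2 * n + 5 := by rw [hC]; field_simp
  generalize y ^ (β - 2) = A at *
  generalize Real.tanh s = T at *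
  generalize Real.tanh t = S at *
  simp only [div_eq_mul_inv] at hineq
  generalize (G s t y)⁻¹ = g at *
  have hbound : (2 + 2 * a + (1 - T ^ 2) + (1 - S ^ 2) + (n - 1) * (T ^ 2 + S ^ 2)) * g
      ≤ (2 * n + 4) * A := by
    refine mul_le_mul ?_ hA hg0.le (by positivity)
    nlinarith
  have hfin : 0 ≤ ε * ((2 + 2 * a + (1 - T ^ 2) + (1 - S ^ 2) + (n - 1) * (T ^ 2 + S ^ 2)) * g
      - (2 * y * g) ^ 2 - (T * g) ^ 2 - (S * g) ^ 2 - C * β ^ 2 * A) := by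
    have hyy : y⁻¹ * y = 1 := inv_mul_cancel₀ hy.ne'
    have haβ : a = 1 - 2 * β := by rw [hβ]; ring
    refine hineq.trans_eq ?_
    linear_combination (ε * a * (2 * g + C * β * A)) * hyy + ε * C * β * A * haβ
  have := nonneg_of_mul_nonneg_right hfin hε
  rw [hCβ] at this
  nlinarith [sq_nonneg (2 * y * g), sq_nonneg (T * g), sq_nonneg (S * g)]

/-- Special case of `BRSolution.doubled_nonneg` for a product barrier. -/
theorem BRSolution.doubled_product_nonpos (hu : BRSolution n a F u) {s t y δ : ℝ} (hy : 0 < y)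
    (hδ : 0 < δ) {p p' q q' k k' : ℝ → ℝ} {p'' q'' k'' : ℝ}
    (hp : ∀ x, HasDerivAt p (p' x) x) (hp' : HasDerivAt p' p'' s)
    (hq : ∀ x, HasDerivAt q (q' x) x) (hq' : HasDerivAt q' q'' t)
    (hk : ∀ x, HasDerivAt k (k' x) x) (hk' : HasDerivAt k' k'' y)
    (mp : IsLocalMin (fun x => u x y - u t y + -(δ * p x * q t * k y)) s)
    (mq : IsLocalMin (fun x => u s y - u x y + -(δ * p s * q x * k y)) t)
    (mk : IsLocalMin (fun x => u s x - u t x + -(δ * p s * q t * k x)) y) :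
    p s * q t * (k'' + a / y * k' y) + q t * k y * (p'' + (n - 1) * Real.tanh s * p' s)
      + p s * k y * (q'' + (n - 1) * Real.tanh t * q' t) ≤ 0 := by
  have key := hu.doubled_nonneg (s := s) (t := t) hy
    (Eventually.of_forall fun x => ((((hp x).const_mul δ).mul_const (q t)).mul_const (k y)).neg)
    ((((hp'.const_mul δ).mul_const (q t)).mul_const (k y)).neg)
    (Eventually.of_forall fun x => (((hq x).const_mul (δ * p s)).mul_const (k y)).neg)
    (((hq'.const_mul (δ * p s)).mul_const (k y)).neg)
    (Eventually.of_forall fun x => ((hk x).const_mul (δ * p s * q t)).neg)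
    ((hk'.const_mul (δ * p s * q t)).neg) mp mq mk
  refine nonpos_of_mul_nonpos_right (a := δ) ?_ hδ
  linear_combination key

set_option maxHeartbeats 1000000 in
/-- Solutions with increasing trace are increasing in `t` at every positive height. -/
theorem BRSolution.strictMono_of_trace (hu : BRSolution n a F u) (hn : 2 ≤ n)
    (ha : a ∈ Set.Ioo (-1 : ℝ) 1) (h0 : StrictMono fun t => u t 0) {y₀ : ℝ} (hy₀ : 0 < y₀) :
    StrictMono fun t => u t y₀ := by
  intro t₀ s₀ hts₀
  simp only
  have hmono : ∀ y, 0 ≤ y → Monotone fun t => u t y := by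
    intro y hy
    rcases hy.eq_or_lt with rfl | hy
    · exact h0.monotone
    · exact hu.monotone_of_trace hn ha h0.monotone hy
  obtain ⟨ha1, ha2⟩ := ha
  have hn' : (2 : ℝ) ≤ n := by exact_mod_cast hn
  set r : ℝ := (s₀ - t₀) / 4 with hr
  have hr0 : 0 < r := by rw [hr]; linarith
  set m : ℝ := (u (s₀ - r) 0 - u (t₀ + r) 0) / 2 with hm
  have hm0 : 0 < m := by
    have : u (t₀ + r) 0 < u (s₀ - r) 0 := h0 (by linarith)
    rw [hm]; linarith
  obtain ⟨η, hη, hηy, hηm⟩ : ∃ η, 0 < η ∧ η < y₀ ∧ m ≤ u (s₀ - r) η - u (t₀ + r) η := by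
    have hc : ContinuousWithinAt (fun y => u (s₀ - r) y - u (t₀ + r) y) (Ioi 0) 0 := by
      have := hu.continuousOn_sub.comp (f := fun y : ℝ => (s₀ - r, t₀ + r, y)) (s := Ici 0)
        (by fun_prop) fun y hy => hy
      exact (this 0 self_mem_Ici).mono Ioi_subset_Ici_self
    have h1 := hc.eventually_const_lt (u := m) (by rw [hm] at hm0 ⊢; linarith)
    obtain ⟨η, h2, h3, h4⟩ := (h1.and (Ioo_mem_nhdsGT hy₀)).exists
    exact ⟨η, h3, h4, h2.le⟩
  set lam : ℝ := (12 + 4 * (n - 1) * r) ^ 2 / (32 * r ^ 2) with hlam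
  have hlam0 : 0 ≤ lam := by positivity
  set μ : ℝ := η⁻¹ + 2 * lam + 1 with hμ
  have hη' : 0 < η⁻¹ := inv_pos.2 hη
  have hμ1 : 1 ≤ μ := by rw [hμ]; linarith
  let k : ℝ → ℝ := fun y => Real.exp (-(μ * y)) - Real.exp (-(μ * (y₀ + 1)))
  set δ : ℝ := m / (r ^ 4 * r ^ 4) with hδ
  have hδ0 : 0 < δ := by positivity
  have hk0 : ∀ y, y ≤ y₀ + 1 → 0 ≤ k y := by
    intro y hy
    refine sub_nonneg.2 (Real.exp_le_exp.2 ?_)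
    nlinarith
  have hk1 : ∀ y, 0 ≤ y → k y ≤ 1 := by
    intro y hy
    have h1 : Real.exp (-(μ * y)) ≤ 1 := Real.exp_le_one_iff.2 (by nlinarith)
    have := Real.exp_pos (-(μ * (y₀ + 1)))
    simp only [k]; linarith
  let V : ℝ → ℝ → ℝ → ℝ := fun s t y => u s y - u t y + -(δ * bump r s₀ s * bump r t₀ t * k y)
  let K : Set (ℝ × ℝ × ℝ) := Icc (s₀ - r) (s₀ + r) ×ˢ Icc (t₀ - r) (t₀ + r) ×ˢ Icc η (y₀ + 1)
  have hK : IsCompact K := isCompact_Icc.prod (isCompact_Icc.prod isCompact_Icc)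
  have hVc : ContinuousOn (fun p : ℝ × ℝ × ℝ => V p.1 p.2.1 p.2.2) K := by
    refine (hu.continuousOn_sub.mono fun p hp => hη.le.trans hp.2.2.1).add
      (Continuous.continuousOn ?_)
    simp only [bump, k]
    fun_prop
  have hp₀ : (s₀, t₀, y₀) ∈ K := by
    refine ⟨⟨?_, ?_⟩, ⟨?_, ?_⟩, ?_, ?_⟩ <;> simp only <;> linarith
  obtain ⟨⟨s, t, y⟩, ⟨hs, ht, hy⟩, hmin⟩ := hK.exists_isMinOn ⟨_, hp₀⟩ hVc
  simp only at hs ht hy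
  have hV0 : V s t y ≤ V s₀ t₀ y₀ := hmin hp₀
  have hpos : 0 < δ * bump r s₀ s₀ * bump r t₀ t₀ * k y₀ := by
    have h1 : 0 < k y₀ := sub_pos.2 (Real.exp_lt_exp.2 (by nlinarith))
    have h2 : 0 < bump r s₀ s₀ := bump_pos (by simpa using hr0)
    have h3 : 0 < bump r t₀ t₀ := bump_pos (by simpa using hr0)
    positivity
  suffices hV : 0 ≤ V s t y by
    simp only [V] at hV hV0
    linarith
  by_contra! hV
  have hy0 : 0 < y := hη.trans_le hy.1
  have hW : 0 ≤ u s y - u t y := sub_nonneg.2 (hmono y hy0.le (by linarith [hs.1, ht.2]))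
  have hP := bump_nonneg r s₀ s
  have hQ := bump_nonneg r t₀ t
  have hbpos : 0 < δ * bump r s₀ s * bump r t₀ t * k y := by
    simp only [V] at hV
    linarith
  have hPne : bump r s₀ s ≠ 0 := by intro h; simp [h] at hbpos
  have hQne : bump r t₀ t ≠ 0 := by intro h; simp [h] at hbpos
  have hkne : k y ≠ 0 := by intro h; simp [h] at hbpos
  have hs1 : s₀ - r < s := lt_of_le_of_ne hs.1 (by rintro rfl; exact hPne (bump_sub _ _))
  have hs2 : s < s₀ + r := lt_of_le_of_ne hs.2 (by rintro rfl; exact hPne (bump_add _ _))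
  have ht1 : t₀ - r < t := lt_of_le_of_ne ht.1 (by rintro rfl; exact hQne (bump_sub _ _))
  have ht2 : t < t₀ + r := lt_of_le_of_ne ht.2 (by rintro rfl; exact hQne (bump_add _ _))
  have hy2 : y < y₀ + 1 := lt_of_le_of_ne hy.2 (by rintro rfl; exact hkne (sub_self _))
  have hsr : |s - s₀| < r := abs_lt.2 ⟨by linarith, by linarith⟩
  have htr : |t - t₀| < r := abs_lt.2 ⟨by linarith, by linarith⟩
  have hy1 : η < y := by
    refine lt_of_le_of_ne hy.1 ?_
    rintro rfl
    have h1 : u (s₀ - r) η ≤ u s η := hmono η hη.le hs1.le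
    have h2 : u t η ≤ u (t₀ + r) η := hmono η hη.le ht2.le
    have h3 : bump r s₀ s * bump r t₀ t ≤ r ^ 4 * r ^ 4 :=
      mul_le_mul (bump_le hsr.le) (bump_le htr.le) hQ (by positivity)
    have h4 : bump r s₀ s * bump r t₀ t * k η ≤ r ^ 4 * r ^ 4 * 1 :=
      mul_le_mul h3 (hk1 η hη.le) (hk0 η hy.2) (by positivity)
    have h5 : δ * (r ^ 4 * r ^ 4) = m := by rw [hδ]; field_simp
    have h6 : δ * (bump r s₀ s * bump r t₀ t * k η) ≤ m := by
      rw [← h5]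
      exact mul_le_mul_of_nonneg_left (by linarith) hδ0.le
    simp only [V] at hV
    linarith
  have hdk : ∀ x, HasDerivAt k (-μ * Real.exp (-(μ * x))) x := fun x =>
    (hasDerivAt_exp_neg_mul μ x).sub_const _
  have key := hu.doubled_product_nonpos (s := s) (t := t) hy0 hδ0
    (hasDerivAt_bump r s₀) (hasDerivAt_bumpDeriv r s₀ s)
    (hasDerivAt_bump r t₀) (hasDerivAt_bumpDeriv r t₀ t)
    hdk ((hasDerivAt_exp_neg_mul μ y).const_mul (-μ))
    (by
      filter_upwards [Ioo_mem_nhds hs1 hs2] with x hx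
      exact hmin (show (x, t, y) ∈ K from ⟨⟨hx.1.le, hx.2.le⟩, ht, hy⟩))
    (by
      filter_upwards [Ioo_mem_nhds ht1 ht2] with x hx
      exact hmin (show (s, x, y) ∈ K from ⟨hs, ⟨hx.1.le, hx.2.le⟩, hy⟩))
    (by
      filter_upwards [Ioo_mem_nhds hy1 hy2] with x hx
      exact hmin (show (s, t, x) ∈ K from ⟨hs, ht, hx.1.le, hx.2.le⟩))
  have hdrift : ∀ x, |((n : ℝ) - 1) * Real.tanh x| ≤ n - 1 := by
    intro x
    rw [abs_mul, abs_of_nonneg (by linarith : (0 : ℝ) ≤ n - 1)]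
    exact mul_le_of_le_one_right (by linarith) (Real.abs_tanh_lt_one x).le
  have b1 := bump_subsolution hr0 (hdrift s) hsr
  have b2 := bump_subsolution hr0 (hdrift t) htr
  rw [← hlam] at b1 b2
  have hPpos : 0 < bump r s₀ s := lt_of_le_of_ne hP hPne.symm
  have hQpos : 0 < bump r t₀ t := lt_of_le_of_ne hQ hQne.symm
  have hkpos : 0 < k y := lt_of_le_of_ne (hk0 y hy2.le) hkne.symm
  have b3 : 2 * lam * k y < _ :=
    exp_barrier_subsolution ha2 hη hy1.le hlam0 hμ (Real.exp_pos (-(μ * (y₀ + 1)))).le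
  have c1 := mul_le_mul_of_nonneg_left b1 (mul_pos hQpos hkpos).le
  have c2 := mul_le_mul_of_nonneg_left b2 (mul_pos hPpos hkpos).le
  have c3 := mul_lt_mul_of_pos_left b3 (mul_pos hPpos hQpos)
  linarith

end BRSolution

/-- Monotonicity of layer solutions: if `u` is a classical solution of the boundary
reaction problem with `|u| < 1`, `∂_t u(·,0) > 0` and `u(t,0) → ±1` as `t → ±∞`,
then for every fixed `y > 0` the function `t ↦ u(t,y)` is strictly increasing. -/
theorem stmt2 (n : ℕ) (hn : 2 ≤ n) (a : ℝ) (ha : a ∈ Set.Ioo (-1:ℝ) 1)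
    (F : ℝ → ℝ) (hF : DoubleWell F) (u : ℝ → ℝ → ℝ)
    (hu : BRSolution n a F u)
    (hb : ∀ t y : ℝ, 0 ≤ y → |u t y| < 1)
    (hm : ∀ t : ℝ, 0 < pt u t 0)
    (hlp : Tendsto (fun t => u t 0) atTop (𝓝 1))
    (hlm : Tendsto (fun t => u t 0) atBot (𝓝 (-1))) :
    ∀ y : ℝ, 0 < y → StrictMono (fun t => u t y) := by
  exact fun y hy => hu.strictMono_of_trace hn ha (strictMono_of_deriv_pos hm) hy
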